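/- arXiv:2401.17204 — 4 statements merged into one kernel-verified Lean document; each statement's English description precedes it below -/
import Mathlib

section
/- Let h : U → ℝ be a non-crossing height function and T a U-tree. Then the set g(T) = {y ∈ ℝ^{b+1} : y_0 = 0, and y_j − h(i,j) ≤ y_{j'} − h(i,j') for every (i,j) ∈ T and every j' with (i,j') ∈ U} consists of exactly one point. -/
/-- A sequence `u 0, …, u a` of positive integers is unimodular if it increases
up to some index `k ≤ a` and decreases afterwards. -/
def IsUnimodular (a : ℕ) (u : ℕ → ℕ) : Prop :=
  (∀ i, i ≤ a → 0 < u i) ∧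
  ∃ k, k ≤ a ∧ (∀ i j, i ≤ j → j ≤ k → u i ≤ u j) ∧
    (∀ i j, k ≤ i → i ≤ j → j ≤ a → u j ≤ u i)

/-- The stack set of the sequence `u 0, …, u a`: the point in column `i` and
row `j` (rows increasing downward) belongs to it iff `i ≤ a` and `j < u i`. -/
def stackSet (a : ℕ) (u : ℕ → ℕ) : Set (ℕ × ℕ) :=
  {p | p.1 ≤ a ∧ p.2 < u p.1}

/-- Two points `p, q` are `U`-incompatible if one is strictly southwest or strictly
northeast of the other and the whole rectangle spanned by them lies inside `U`. -/
def Incompat (U : Set (ℕ × ℕ)) (p q : ℕ × ℕ) : Prop :=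
  ((p.1 < q.1 ∧ q.2 < p.2) ∨ (q.1 < p.1 ∧ p.2 < q.2)) ∧
  ∀ k l : ℕ, min p.1 q.1 ≤ k → k ≤ max p.1 q.1 → min p.2 q.2 ≤ l → l ≤ max p.2 q.2 →
    (k, l) ∈ U

/-- `U`-compatibility. -/
def Compat (U : Set (ℕ × ℕ)) (p q : ℕ × ℕ) : Prop := ¬ Incompat U p q

/-- A `U`-tree is a maximal (under inclusion) pairwise `U`-compatible subset of `U`. -/
def IsUTree (U T : Set (ℕ × ℕ)) : Prop :=
  T ⊆ U ∧ T.Pairwise (Compat U) ∧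
    ∀ T' : Set (ℕ × ℕ), T' ⊆ U → T'.Pairwise (Compat U) → T ⊆ T' → T' = T

/-- A height function `h` on `U` is non-crossing if for every rectangle with its four
corners in `U`, the sum of the heights of the upper-left and lower-right corners is
strictly bigger than the sum of the heights of the lower-left and upper-right corners. -/
def NonCrossing (U : Set (ℕ × ℕ)) (h : ℕ × ℕ → ℝ) : Prop :=
  ∀ i i' j j' : ℕ, i < i' → j < j' → (i, j) ∈ U → (i, j') ∈ U → (i', j) ∈ U →
    (i', j') ∈ U → h (i, j') + h (i', j) < h (i, j) + h (i', j')

/-- The polyhedral cell `g(A) ⊆ ℝ^{b+1}` associated to a subset `A` of `U` and a height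
function `h`: the set of `y` with `y_0 = 0` and `y_j − h(i,j) ≤ y_{j'} − h(i,j')` for
every `(i,j) ∈ A` and every `j'` with `(i,j') ∈ U`. -/
def gSet (b : ℕ) (U A : Set (ℕ × ℕ)) (h : ℕ × ℕ → ℝ) : Set (Fin (b + 1) → ℝ) :=
  {y | y 0 = 0 ∧ ∀ (i : ℕ) (j j' : Fin (b + 1)),
    (i, (j : ℕ)) ∈ A → (i, (j' : ℕ)) ∈ U →
      y j - h (i, (j : ℕ)) ≤ y j' - h (i, (j' : ℕ))}

/-- A maximal set `T` of pairwise compatible points of `{(i, j) | i ∈ C, j < u i}`, where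
compatibility only tests the lower right corner of a spanned rectangle. -/
structure IsCornerTree (C : Finset ℕ) (u : ℕ → ℕ) (T : Set (ℕ × ℕ)) : Prop where
  mem : ∀ i j, (i, j) ∈ T → i ∈ C ∧ j < u i
  compat : ∀ i j i' j', (i, j) ∈ T → (i', j') ∈ T → i < i' → j' < j → u i' ≤ j
  maximal : ∀ i j, i ∈ C → j < u i →
    (∀ i' j', (i', j') ∈ T → (i < i' → j' < j → u i' ≤ j) ∧ (i' < i → j < j' → u i ≤ j')) →
    (i, j) ∈ T

/-- The difference inequalities which cut out `gSet`, with `y` indexed by all of `ℕ`. -/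
def SatisfiesCell (u : ℕ → ℕ) (T : Set (ℕ × ℕ)) (h : ℕ × ℕ → ℝ) (y : ℕ → ℝ) : Prop :=
  y 0 = 0 ∧ ∀ i j, (i, j) ∈ T → ∀ j', j' < u i → y j - h (i, j) ≤ y j' - h (i, j')

/-- The non-crossing condition on the columns in `C` with heights `u`. -/
def NonCrossingOn (C : Finset ℕ) (u : ℕ → ℕ) (h : ℕ × ℕ → ℝ) : Prop :=
  ∀ i ∈ C, ∀ i' ∈ C, ∀ j j', i < i' → j < j' → j' < u i → j' < u i' →
    h (i, j') + h (i', j) < h (i, j) + h (i', j')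

/-- Every column meets `T`, and the cell of `T` is a single point in the coordinates `0, …, b`. -/
def HasUniqueSolution (C : Finset ℕ) (u : ℕ → ℕ) (T : Set (ℕ × ℕ)) (h : ℕ × ℕ → ℝ) (b : ℕ) :
    Prop :=
  (∀ i ∈ C, ∃ j, (i, j) ∈ T) ∧
    ∃ y, SatisfiesCell u T h y ∧ ∀ y', SatisfiesCell u T h y' → ∀ j ≤ b, y' j = y j

namespace IsCornerTree

variable {C : Finset ℕ} {u : ℕ → ℕ} {T : Set (ℕ × ℕ)} {h : ℕ × ℕ → ℝ} {b q : ℕ}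

theorem last_mem (hT : IsCornerTree C u T) (hub : ∀ i ∈ C, u i ≤ b + 1) (hq : q ∈ C)
    (huq : u q = b + 1) (hlast : ∀ i ∈ C, u i = b + 1 → i ≤ q) : (q, b) ∈ T := by
  refine hT.maximal q b hq (by omega) fun i' j' hm => ⟨fun hlt _ => ?_, fun _ hlt => ?_⟩
  · have hi := (hT.mem _ _ hm).1
    have := hub i' hi
    have := mt (hlast i' hi)
    omega
  · omega

/-- Removing the bottom row when it meets the tree in its last point only. -/
theorem eraseRow (hT : IsCornerTree C u T) (hub : ∀ i ∈ C, u i ≤ b + 1) (hq : q ∈ C)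
    (huq : u q = b + 1) (hlast : ∀ i ∈ C, u i = b + 1 → i ≤ q)
    (hrow : ∀ i, (i, b) ∈ T → i = q) :
    IsCornerTree C (fun i => min (u i) b) {p | p ∈ T ∧ p.2 ≠ b} where
  mem i j hm := by
    obtain ⟨hi, hj⟩ := hT.mem i j hm.1
    have := hub i hi
    have : j ≠ b := hm.2
    exact ⟨hi, lt_min hj (by omega)⟩
  compat i j i' j' hm hm' hi hj :=
    (min_le_left _ _).trans (hT.compat i j i' j' hm.1 hm'.1 hi hj)
  maximal i j hi hj hc := by
    obtain ⟨hju, hjb⟩ := lt_min_iff.1 hj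
    refine ⟨hT.maximal i j hi hju fun i' j' hm => ?_, hjb.ne⟩
    by_cases hb : j' = b
    · subst hb
      obtain rfl := hrow i' hm
      refine ⟨fun _ _ => by omega, fun hlt _ => ?_⟩
      have := hub i hi
      have := mt (hlast i hi)
      omega
    · obtain ⟨h₁, h₂⟩ := hc i' j' ⟨hm, hb⟩
      have := hT.mem _ _ hm
      have := hub i' this.1
      simp only [min_le_iff] at h₁ h₂
      refine ⟨fun x y => ?_, fun x y => ?_⟩
      · have := h₁ x y
        omega
      · have := h₂ x y
        omega

/-- Removing the last column of maximal height. -/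
theorem eraseColumn (hT : IsCornerTree C u T) (hub : ∀ i ∈ C, u i ≤ b + 1)
    (hlast : ∀ i ∈ C, u i = b + 1 → i ≤ q) (huq : u q = b + 1)
    (hcol : ∀ j, (q, j) ∈ T → j = b) :
    IsCornerTree (C.erase q) u {p | p ∈ T ∧ p.1 ≠ q} where
  mem i j hm := ⟨Finset.mem_erase.2 ⟨hm.2, (hT.mem i j hm.1).1⟩, (hT.mem i j hm.1).2⟩
  compat i j i' j' hm hm' := hT.compat i j i' j' hm.1 hm'.1
  maximal i j hi hj hc := by
    obtain ⟨hne, hiC⟩ := Finset.mem_erase.1 hi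
    refine ⟨hT.maximal i j hiC hj fun i' j' hm => ?_, hne⟩
    have := hub i hiC
    by_cases hb : i' = q
    · subst hb
      obtain rfl := hcol j' hm
      refine ⟨fun _ _ => by omega, fun hlt _ => ?_⟩
      have := mt (hlast i hiC)
      omega
    · exact hc i' j' ⟨hm, hb⟩

theorem hasUniqueSolution_of_eraseRow (hT : IsCornerTree C u T)
    (hub : ∀ i ∈ C, u i ≤ b + 2) (hq : q ∈ C) (huq : u q = b + 2)
    (hlast : ∀ i ∈ C, u i = b + 2 → i ≤ q) (hrow : ∀ i, (i, b + 1) ∈ T → i = q)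
    (hqT : (q, b + 1) ∈ T) (hnc : NonCrossingOn C u h)
    (ih : HasUniqueSolution C (fun i => min (u i) (b + 1)) {p | p ∈ T ∧ p.2 ≠ b + 1} h b) :
    HasUniqueSolution C u T h (b + 1) := by
  obtain ⟨hcols, y, ⟨hy0, hy⟩, huniq⟩ := ih
  obtain ⟨j₀, hj₀T, hj₀⟩ := hcols q hq
  have hj₀u := (hT.mem _ _ hj₀T).2
  replace hj₀ : j₀ ≠ b + 1 := hj₀
  have hj₀b : j₀ < b + 1 := by omega
  refine ⟨fun i hi => (hcols i hi).imp fun _ hj => hj.1,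
    fun j => if j = b + 1 then h (q, b + 1) + (y j₀ - h (q, j₀)) else y j, ⟨by simp [hy0], ?_⟩,
    fun y' hy' j hj => ?_⟩
  · intro i j hm j' hj'
    obtain ⟨hi, hju⟩ := hT.mem i j hm
    have hui := hub i hi
    by_cases hjb : j = b + 1
    · subst hjb
      obtain rfl := hrow i hm
      by_cases hjb' : j' = b + 1
      · simp [hjb']
      · have := hy i j₀ ⟨hj₀T, hj₀⟩ j' (lt_min hj' (by omega))
        simp only [if_true, if_neg hjb']
        linarith
    · by_cases hjb' : j' = b + 1
      · subst hjb'
        simp only [if_true, if_neg hjb]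
        have h₁ := hy i j ⟨hm, hjb⟩ j₀ (lt_min (by omega) hj₀b)
        rcases (hlast i hi (by omega)).lt_or_eq with hlt | rfl
        · have := hnc i hi q hq j₀ (b + 1) hlt hj₀b hj' (by omega)
          linarith
        · linarith
      · simp only [if_neg hjb, if_neg hjb']
        exact hy i j ⟨hm, hjb⟩ j' (lt_min hj' (by omega))
  · have heq := huniq y' ⟨hy'.1, fun i j hm j' hj' => hy'.2 i j hm.1 j' (lt_min_iff.1 hj').1⟩
    by_cases hjb : j = b + 1
    · subst hjb
      have h₁ := hy'.2 q (b + 1) hqT j₀ hj₀u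
      have h₂ := hy'.2 q j₀ hj₀T (b + 1) (by omega)
      have h₃ := heq j₀ (by omega)
      simp only [if_true]
      linarith
    · simp only [if_neg hjb]
      exact heq j (by omega)

theorem hasUniqueSolution_of_eraseColumn {i₀ : ℕ} (hT : IsCornerTree C u T)
    (hq : q ∈ C) (huq : u q = b + 1) (hcol : ∀ j, (q, j) ∈ T → j = b)
    (hqT : (q, b) ∈ T) (hi₀ : i₀ < q) (hi₀T : (i₀, b) ∈ T)
    (hub : ∀ i ∈ C, u i ≤ b + 1) (hnc : NonCrossingOn C u h)
    (ih : HasUniqueSolution (C.erase q) u {p | p ∈ T ∧ p.1 ≠ q} h b) :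
    HasUniqueSolution C u T h b := by
  obtain ⟨hcols, y, ⟨hy0, hy⟩, huniq⟩ := ih
  refine ⟨fun i hi => ?_, y, ⟨hy0, fun i j hm j' hj' => ?_⟩, fun y' hy' =>
    huniq y' ⟨hy'.1, fun i j hm => hy'.2 i j hm.1⟩⟩
  · by_cases hiq : i = q
    · exact ⟨b, hiq ▸ hqT⟩
    · exact (hcols i (Finset.mem_erase.2 ⟨hiq, hi⟩)).imp fun _ hj => hj.1
  · by_cases hiq : i = q
    · subst hiq
      obtain rfl := hcol j hm
      obtain ⟨hi₀C, hi₀u⟩ := hT.mem _ _ hi₀T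
      rcases (show j' ≤ j by omega).lt_or_eq with hlt | rfl
      · have h₁ := hy i₀ j ⟨hi₀T, hi₀.ne⟩ j' (hlt.trans hi₀u)
        have h₂ := hnc i₀ hi₀C i hq j' j hi₀ hlt hi₀u (by omega)
        linarith
      · exact le_rfl
    · exact hy i j ⟨hm, hiq⟩ j' hj'

theorem hasUniqueSolution (hT : IsCornerTree C u T) (hpos : ∀ i ∈ C, 0 < u i)
    (hub : ∀ i ∈ C, u i ≤ b + 1) (hmax : ∃ i ∈ C, u i = b + 1) (hnc : NonCrossingOn C u h) :
    HasUniqueSolution C u T h b := by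
  induction hN : b + C.card generalizing b C u T with
  | zero =>
    obtain ⟨i, hi, -⟩ := hmax
    have := Finset.card_pos.2 ⟨i, hi⟩
    omega
  | succ N ih =>
    cases b with
    | zero =>
      refine ⟨fun i hi => ⟨0, hT.maximal i 0 hi (hpos i hi) fun i' j' hm => ?_⟩, fun _ => 0,
        ⟨rfl, fun i j hm j' hj' => ?_⟩, fun y' hy' j hj => ?_⟩
      · have := hub i hi
        exact ⟨fun _ _ => by omega, fun _ _ => by omega⟩
      · obtain ⟨hi, hj⟩ := hT.mem i j hm
        have := hub i hi
        obtain rfl : j = 0 := by omega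
        obtain rfl : j' = 0 := by omega
        exact le_rfl
      · obtain rfl : j = 0 := by omega
        exact hy'.1
    | succ b =>
      obtain ⟨q, hqmem, hlast'⟩ := Finset.exists_max_image (C.filter fun i => u i = b + 2) id
        (by obtain ⟨i, hi, hui⟩ := hmax; exact ⟨i, Finset.mem_filter.2 ⟨hi, hui⟩⟩)
      obtain ⟨hq, huq⟩ := Finset.mem_filter.1 hqmem
      have hlast : ∀ i ∈ C, u i = b + 2 → i ≤ q := fun i hi hui =>
        hlast' i (Finset.mem_filter.2 ⟨hi, hui⟩)
      have hqT := hT.last_mem hub hq huq hlast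
      by_cases hrow : ∀ i, (i, b + 1) ∈ T → i = q
      · refine hT.hasUniqueSolution_of_eraseRow hub hq huq hlast hrow hqT hnc
          (ih (hT.eraseRow hub hq huq hlast hrow) (fun i hi => lt_min (hpos i hi) (by omega))
            (fun i _ => min_le_right _ _) ⟨q, hq, by simp [huq]⟩ ?_ (by omega))
        intro i hi i' hi' j j' hlt hlt' hj hj'
        exact hnc i hi i' hi' j j' hlt hlt' (lt_min_iff.1 hj).1 (lt_min_iff.1 hj').1
      · push Not at hrow
        obtain ⟨i₀, hi₀T, hne⟩ := hrow
        obtain ⟨hi₀C, hi₀u⟩ := hT.mem _ _ hi₀T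
        have hui₀ : u i₀ = b + 2 := by
          have := hub i₀ hi₀C
          omega
        have hi₀ : i₀ < q := lt_of_le_of_ne (hlast i₀ hi₀C hui₀) hne
        have hcol : ∀ j, (q, j) ∈ T → j = b + 1 := fun j hj => by
          have := (hT.mem _ _ hj).2
          have := hT.compat _ _ _ _ hi₀T hj hi₀
          omega
        have hcard := Finset.card_erase_add_one hq
        refine hT.hasUniqueSolution_of_eraseColumn hq huq hcol hqT hi₀ hi₀T hub hnc
          (ih (hT.eraseColumn hub hlast huq hcol) (fun i hi => hpos i (Finset.mem_of_mem_erase hi))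
            (fun i hi => hub i (Finset.mem_of_mem_erase hi))
            ⟨i₀, Finset.mem_erase.2 ⟨hne, hi₀C⟩, hui₀⟩ ?_ (by omega))
        exact fun i hi i' hi' =>
          hnc i (Finset.mem_of_mem_erase hi) i' (Finset.mem_of_mem_erase hi')

end IsCornerTree

theorem Incompat.symm {U : Set (ℕ × ℕ)} {p q : ℕ × ℕ} (hpq : Incompat U p q) :
    Incompat U q p := by
  refine ⟨hpq.1.symm, ?_⟩
  simpa only [min_comm q.1, max_comm q.1, min_comm q.2, max_comm q.2] using hpq.2

theorem IsUnimodular.min_le {a : ℕ} {u : ℕ → ℕ} (hu : IsUnimodular a u) {i k i' : ℕ}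
    (hik : i ≤ k) (hki : k ≤ i') (hi' : i' ≤ a) : min (u i) (u i') ≤ u k := by
  obtain ⟨-, m, -, hinc, hdec⟩ := hu
  rcases le_total k m with hkm | hmk
  · exact (min_le_left _ _).trans (hinc i k hik hkm)
  · exact (min_le_right _ _).trans (hdec k i' hmk hki hi')

theorem IsUnimodular.incompat_iff {a : ℕ} {u : ℕ → ℕ} (hu : IsUnimodular a u) {i j i' j' : ℕ}
    (hi : i < i') (hi' : i' ≤ a) (hj : j < u i) :
    Incompat (stackSet a u) (i, j) (i', j') ↔ j' < j ∧ j < u i' := by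
  constructor
  · rintro ⟨hlt | hlt, hrect⟩
    · exact ⟨hlt.2, (hrect i' j (by simp) (by simp) (by simp) (by simp)).2⟩
    · exact absurd hlt.1 hi.not_gt
  · rintro ⟨hlt, hju⟩
    refine ⟨Or.inl ⟨hi, hlt⟩, fun k l h₁ h₂ _ h₄ => ?_⟩
    simp only [min_eq_left hi.le, max_eq_right hi.le, max_eq_left hlt.le] at h₁ h₂ h₄
    exact ⟨h₂.trans hi', h₄.trans_lt ((lt_min hj hju).trans_le (hu.min_le h₁ h₂ hi'))⟩

theorem IsUTree.mem_of_compat {U T : Set (ℕ × ℕ)} (hT : IsUTree U T) {p : ℕ × ℕ} (hp : p ∈ U)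
    (hc : ∀ q ∈ T, Compat U p q) : p ∈ T := by
  obtain ⟨hsub, hpair, hmax⟩ := hT
  rw [← hmax (insert p T) (Set.insert_subset hp hsub) (hpair.insert fun q hq _ =>
    ⟨hc q hq, fun hi => hc q hq hi.symm⟩) (Set.subset_insert p T)]
  exact Set.mem_insert p T

theorem IsUTree.isCornerTree {a : ℕ} {u : ℕ → ℕ} (hu : IsUnimodular a u) {T : Set (ℕ × ℕ)}
    (hT : IsUTree (stackSet a u) T) : IsCornerTree (Finset.range (a + 1)) u T where
  mem i j hm := ⟨Finset.mem_range_succ_iff.2 (hT.1 hm).1, (hT.1 hm).2⟩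
  compat i j i' j' hm hm' hi hj := by
    by_contra! hlt
    exact hT.2.1 hm hm' (fun he => hi.ne (congrArg Prod.fst he))
      ((hu.incompat_iff hi (hT.1 hm').1 (hT.1 hm).2).2 ⟨hj, hlt⟩)
  maximal i j hi hj hc := by
    have hia := Finset.mem_range_succ_iff.1 hi
    refine hT.mem_of_compat ⟨hia, hj⟩ ?_
    rintro ⟨i', j'⟩ hm hinc
    obtain ⟨h₁, h₂⟩ := hc i' j' hm
    rcases lt_trichotomy i i' with hlt | rfl | hlt
    · obtain ⟨h₃, h₄⟩ := (hu.incompat_iff hlt (hT.1 hm).1 hj).1 hinc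
      exact (h₁ hlt h₃).not_gt h₄
    · exact hinc.1.elim (fun h₃ => lt_irrefl _ h₃.1) fun h₃ => lt_irrefl _ h₃.1
    · obtain ⟨h₃, h₄⟩ := (hu.incompat_iff hlt hia (hT.1 hm).2).1 hinc.symm
      exact (h₂ hlt h₃).not_gt h₄

/-- For a non-crossing height function `h` and a `U`-tree `T`, the set
`g(T)` consists of exactly one point. -/
theorem gset_of_utree_is_singleton (a b : ℕ) (u : ℕ → ℕ) (hu : IsUnimodular a u)
    (hub : ∀ i, i ≤ a → u i ≤ b + 1) (hmax : ∃ i, i ≤ a ∧ u i = b + 1)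
    (h : ℕ × ℕ → ℝ) (hnc : NonCrossing (stackSet a u) h)
    (T : Set (ℕ × ℕ)) (hT : IsUTree (stackSet a u) T) :
    ∃ y : Fin (b + 1) → ℝ, gSet b (stackSet a u) T h = {y} := by
  have hle : ∀ {i}, i ∈ Finset.range (a + 1) → i ≤ a := Finset.mem_range_succ_iff.1
  obtain ⟨-, y, ⟨hy0, hy⟩, huniq⟩ := (hT.isCornerTree hu).hasUniqueSolution
    (h := h) (b := b) (fun i hi => hu.1 i (hle hi)) (fun i hi => hub i (hle hi))
    (hmax.imp fun i hi => ⟨Finset.mem_range_succ_iff.2 hi.1, hi.2⟩)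
    (fun i hi i' hi' j j' hlt hlt' hj hj' => hnc i i' j j' hlt hlt' ⟨hle hi, hlt'.trans hj⟩
      ⟨hle hi, hj⟩ ⟨hle hi', hlt'.trans hj'⟩ ⟨hle hi', hj'⟩)
  refine ⟨fun j => y j, Set.eq_singleton_iff_unique_mem.2
    ⟨⟨hy0, fun i j j' hm hU => hy i j hm j' hU.2⟩, fun y' hy' => ?_⟩⟩
  have hsat : SatisfiesCell u T h fun j => if hj : j < b + 1 then y' ⟨j, hj⟩ else 0 := by
    refine ⟨by simpa using hy'.1, fun i j hm j' hj' => ?_⟩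
    obtain ⟨hi, hj⟩ := hT.1 hm
    have hjb := hj.trans_le (hub i hi)
    have hjb' := hj'.trans_le (hub i hi)
    simpa only [dif_pos hjb, dif_pos hjb'] using hy'.2 i ⟨j, hjb⟩ ⟨j', hjb'⟩ hm ⟨hi, hj'⟩
  funext j
  simpa only [dif_pos j.2] using huniq _ hsat j (Nat.lt_succ_iff.1 j.2)
end

section
/- Let h : U → ℝ be a non-crossing height function, T a U-tree, and k ∈ {1,…,b}. Then there exist ℓ ≥ 1, columns i_1 ≥ i_2 ≥ ⋯ ≥ i_ℓ ≥ 0 and rows k = j_1 > j_2 > ⋯ > j_ℓ > j_{ℓ+1} = 0 such that (i_m, j_m) ∈ T and (i_m, j_{m+1}) ∈ T for all 1 ≤ m ≤ ℓ, and the unique point y of g(T) satisfies y_k = Σ_{m=1}^{ℓ} (h(i_m, j_m) − h(i_m, j_{m+1})). -/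
/-- A chain of corners of the staircase path in `T` joining row `k` to row `0`: columns
`I 1 ≥ I 2 ≥ ⋯ ≥ I L` and rows `k = J 1 > J 2 > ⋯ > J L > J (L+1) = 0` with
`(I m, J m) ∈ T` (bottom corners) and `(I m, J (m+1)) ∈ T` (top corners) for all
`1 ≤ m ≤ L`. -/
def ChainIn (T : Set (ℕ × ℕ)) (k L : ℕ) (I J : ℕ → ℕ) : Prop :=
  1 ≤ L ∧ J 1 = k ∧ J (L + 1) = 0 ∧
  (∀ m, 1 ≤ m → m + 1 ≤ L → I (m + 1) ≤ I m) ∧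
  (∀ m, 1 ≤ m → m ≤ L → J (m + 1) < J m) ∧
  (∀ m, 1 ≤ m → m ≤ L → (I m, J m) ∈ T ∧ (I m, J (m + 1)) ∈ T)

/-- `(i, j)` lies strictly southwest of `(i', j')` and the rectangle they span is contained in
the stack set of `u`. -/
def SpansSW (a : ℕ) (u : ℕ → ℕ) (i j i' j' : ℕ) : Prop :=
  i < i' ∧ j' < j ∧ ∀ c, i ≤ c → c ≤ i' → c ≤ a ∧ j < u c

theorem incompat_stackSet_iff {a : ℕ} {u : ℕ → ℕ} {i j i' j' : ℕ} :
    Incompat (stackSet a u) (i, j) (i', j') ↔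
      SpansSW a u i j i' j' ∨ SpansSW a u i' j' i j := by
  simp only [Incompat, SpansSW, stackSet, Set.mem_ofPred_eq]
  constructor
  · rintro ⟨h | h, hr⟩
    · exact Or.inl ⟨h.1, h.2, fun c h1 h2 =>
        hr c j (by omega) (by omega) (by omega) (by omega)⟩
    · exact Or.inr ⟨h.1, h.2, fun c h1 h2 =>
        hr c j' (by omega) (by omega) (by omega) (by omega)⟩
  · rintro (⟨h1, h2, h3⟩ | ⟨h1, h2, h3⟩)
    · refine ⟨Or.inl ⟨h1, h2⟩, fun c l hc hc' _ hl => ?_⟩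
      have := h3 c (by omega) (by omega)
      omega
    · refine ⟨Or.inr ⟨h1, h2⟩, fun c l hc hc' _ hl => ?_⟩
      have := h3 c (by omega) (by omega)
      omega

namespace IsUTree

variable {a : ℕ} {u : ℕ → ℕ} {T : Set (ℕ × ℕ)}

theorem not_spansSW (hT : IsUTree (stackSet a u) T) {i j i' j' : ℕ}
    (hp : (i, j) ∈ T) (hq : (i', j') ∈ T) : ¬ SpansSW a u i j i' j' := fun h =>
  hT.2.1 hp hq (fun e => h.1.ne (congrArg Prod.fst e)) (incompat_stackSet_iff.2 (Or.inl h))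

theorem exists_spansSW_of_notMem (hT : IsUTree (stackSet a u) T) {i j : ℕ}
    (hi : i ≤ a) (hj : j < u i) (hn : (i, j) ∉ T) :
    ∃ i' j', (i', j') ∈ T ∧ (SpansSW a u i j i' j' ∨ SpansSW a u i' j' i j) := by
  by_contra! hc
  refine hn ?_
  rw [← hT.2.2 (insert (i, j) T) (Set.insert_subset ⟨hi, hj⟩ hT.1) ?_ (Set.subset_insert _ _)]
  · exact Set.mem_insert _ _
  · refine hT.2.1.insert fun q hq _ => ⟨fun hI => ?_, fun hI => ?_⟩
    · have h1 := hc q.1 q.2 hq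
      exact (incompat_stackSet_iff.1 hI).elim h1.1 h1.2
    · have h1 := hc q.1 q.2 hq
      exact (incompat_stackSet_iff.1 hI).elim h1.2 h1.1

/-- Every nonempty row of the stack set meets every tree. -/
theorem exists_mem_row (hT : IsUTree (stackSet a u) T) {k : ℕ} (hk : ∃ i, i ≤ a ∧ k < u i) :
    ∃ i, (i, k) ∈ T := by
  classical
  by_contra! hn
  obtain ⟨hla, hlk⟩ := Nat.find_spec hk
  set l := Nat.find hk with hl
  have left : ∀ i j, k ≤ j → i < l → ¬ SpansSW a u i j l k := by
    intro i j hj hi h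
    have := h.2.2 i le_rfl h.1.le
    exact Nat.find_min hk hi ⟨this.1, by omega⟩
  let P : ℕ → Prop := fun i => ∃ j, (i, j) ∈ T ∧ SpansSW a u l k i j
  have hP : ∃ i, P i := by
    obtain ⟨i, j, hij, h | h⟩ := hT.exists_spansSW_of_notMem hla hlk (hn l)
    · exact ⟨i, j, hij, h⟩
    · exact (left i j h.2.1.le h.1 h).elim
  have hPa : ∀ i, P i → i ≤ a := fun i ⟨j, hij, _⟩ => (hT.1 hij).1
  obtain ⟨i₀, hi₀⟩ := hP
  have hm : P (Nat.findGreatest P a) := Nat.findGreatest_spec (hPa _ hi₀) hi₀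
  have hmax : ∀ i, P i → i ≤ Nat.findGreatest P a := fun i hi =>
    Nat.le_findGreatest (hPa i hi) hi
  set m := Nat.findGreatest P a
  obtain ⟨j, hmj, hlm, hjk, hr⟩ := hm
  have hmk := hr m hlm.le le_rfl
  obtain ⟨i', j', hij', h | h⟩ := hT.exists_spansSW_of_notMem hmk.1 hmk.2 (hn m)
  · refine absurd (hmax i' ⟨j', hij', hlm.trans h.1, h.2.1, fun c hc hc' => ?_⟩)
      (by have := h.1; omega)
    rcases le_total c m with hcm | hcm
    · exact hr c hc hcm
    · exact h.2.2 c hcm hc'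
  · exact hT.not_spansSW hij' hmj ⟨h.1, hjk.trans h.2.1, h.2.2⟩

/-- The leftmost tree point in a row other than the top one has a tree point above it. -/
theorem exists_mem_above (hT : IsUTree (stackSet a u) T) {i k : ℕ} (hk : 0 < k)
    (hik : (i, k) ∈ T) (hleft : ∀ i', (i', k) ∈ T → i ≤ i') : ∃ j, j < k ∧ (i, j) ∈ T := by
  classical
  by_contra! hn
  obtain ⟨hia, hki⟩ : i ≤ a ∧ k < u i := hT.1 hik
  let P : ℕ → Prop := fun j => ∃ i', (i', j) ∈ T ∧ SpansSW a u i' j i 0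
  have below : ∀ i' j' j, (i', j') ∈ T → SpansSW a u i' j' i j → j' < k := by
    intro i' j' j hij h
    by_contra! hc
    rcases hc.eq_or_lt with rfl | hc
    · have := hleft i' hij
      have := h.1
      omega
    · exact hT.not_spansSW hij hik ⟨h.1, hc, h.2.2⟩
  have hPk : ∀ j, P j → j ≤ k := fun j ⟨i', hij, h⟩ => (below i' j 0 hij h).le
  obtain ⟨j₀, hj₀⟩ : ∃ j, P j := by
    obtain ⟨i', j', hij, h | h⟩ :=
      hT.exists_spansSW_of_notMem hia (hk.trans hki) (hn 0 hk)
    · exact absurd h.2.1 (by omega)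
    · exact ⟨j', i', hij, h⟩
  have hm : P (Nat.findGreatest P k) := Nat.findGreatest_spec (hPk _ hj₀) hj₀
  have hmax : ∀ j, P j → j ≤ Nat.findGreatest P k := fun j hj =>
    Nat.le_findGreatest (hPk j hj) hj
  set m := Nat.findGreatest P k
  obtain ⟨p, hpm, hp⟩ := hm
  have hmk := below p m 0 hpm hp
  obtain ⟨i', j', hij, h | h⟩ :=
    hT.exists_spansSW_of_notMem hia (hmk.trans hki) (hn m hmk)
  · refine hT.not_spansSW hpm hij ⟨hp.1.trans h.1, h.2.1, fun c hc hc' => ?_⟩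
    rcases le_total c i with hci | hci
    · exact hp.2.2 c hc hci
    · exact h.2.2 c hci hc'
  · exact absurd (hmax j' ⟨i', hij, h.1, (Nat.zero_le _).trans_lt h.2.1, h.2.2⟩)
      (by have := h.2.1; omega)

/-- From every tree point outside the top row there is a chain in the tree that starts in the
same row, weakly to the left of that point. -/
theorem exists_chainIn (hT : IsUTree (stackSet a u) T) (k : ℕ) (hk : 0 < k) (i : ℕ)
    (hik : (i, k) ∈ T) : ∃ L I J, ChainIn T k L I J ∧ I 1 ≤ i := by
  classical
  induction k using Nat.strong_induction_on generalizing i with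
  | _ k ih =>
  have hex : ∃ i, (i, k) ∈ T := ⟨i, hik⟩
  have hc := Nat.find_spec hex
  have hci : Nat.find hex ≤ i := Nat.find_min' hex hik
  obtain ⟨j, hjk, hj⟩ := hT.exists_mem_above hk hc fun i' h => Nat.find_min' hex h
  set c := Nat.find hex
  rcases Nat.eq_zero_or_pos j with rfl | hj0
  · refine ⟨1, fun _ => c, fun m => if m = 1 then k else 0, ⟨le_rfl, by simp, by simp, ?_, ?_, ?_⟩,
      hci⟩
    · intros; exact le_rfl
    · intro m h1 h2
      obtain rfl : m = 1 := by omega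
      simpa using hk
    · intro m h1 h2
      obtain rfl : m = 1 := by omega
      simpa using ⟨hc, hj⟩
  · obtain ⟨L, I, J, ⟨hL, hJ1, hJL, hI, hJ, hmem⟩, hI1⟩ := ih j hjk hj0 c hj
    refine ⟨L + 1, fun m => if m = 1 then c else I (m - 1),
      fun m => if m = 1 then k else J (m - 1), ⟨by omega, by simp, by simpa using hJL, ?_, ?_, ?_⟩,
      by simpa using hci⟩
    · rintro (_ | _ | m) h1 h2
      · omega
      · simpa using hI1
      · simpa using hI (m + 1) (by omega) (by omega)
    · rintro (_ | _ | m) h1 h2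
      · omega
      · simpa [hJ1] using hjk
      · simpa using hJ (m + 1) (by omega) (by omega)
    · rintro (_ | _ | m) h1 h2
      · omega
      · simpa [hJ1] using ⟨hc, hj⟩
      · simpa using hmem (m + 1) (by omega) (by omega)

end IsUTree

theorem gSet_sub_eq_sub {b : ℕ} {U T : Set (ℕ × ℕ)} {h : ℕ × ℕ → ℝ} (hTU : T ⊆ U)
    {y : Fin (b + 1) → ℝ} (hy : y ∈ gSet b U T h) {i : ℕ} {j j' : Fin (b + 1)}
    (hj : (i, (j : ℕ)) ∈ T) (hj' : (i, (j' : ℕ)) ∈ T) :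
    h (i, (j : ℕ)) - h (i, (j' : ℕ)) = y j - y j' := by
  have h1 := hy.2 i j j' hj (hTU hj')
  have h2 := hy.2 i j' j hj' (hTU hj)
  linarith

/-- The height differences along a chain in `T` telescope to a coordinate of a point of
`g(T)`. -/
theorem ChainIn.sum_eq {b : ℕ} {U T : Set (ℕ × ℕ)} {h : ℕ × ℕ → ℝ} (hTU : T ⊆ U)
    (hb : ∀ p ∈ T, p.2 < b + 1) {y : Fin (b + 1) → ℝ} (hy : y ∈ gSet b U T h) {k L : ℕ}
    {I J : ℕ → ℕ} (hC : ChainIn T k L I J) (hk : k < b + 1) :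
    ∑ m ∈ Finset.Icc 1 L, (h (I m, J m) - h (I m, J (m + 1))) = y ⟨k, hk⟩ := by
  obtain ⟨hL, hJ1, hJL, -, -, hmem⟩ := hC
  let z : ℕ → ℝ := fun j => if hj : j < b + 1 then y ⟨j, hj⟩ else 0
  have hz : ∀ m ∈ Finset.Icc 1 L,
      h (I m, J m) - h (I m, J (m + 1)) = -(z (J (m + 1)) - z (J m)) := by
    intro m hm
    obtain ⟨h1, h2⟩ := hmem m (Finset.mem_Icc.1 hm).1 (Finset.mem_Icc.1 hm).2
    have := gSet_sub_eq_sub hTU hy (j := ⟨J m, hb _ h1⟩) (j' := ⟨J (m + 1), hb _ h2⟩) h1 h2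
    simp only [z, dif_pos (hb _ h1), dif_pos (hb _ h2)]
    linarith
  have h0 : z 0 = 0 := by simpa [z] using hy.1
  rw [Finset.sum_congr rfl hz, Finset.sum_neg_distrib, ← Finset.Ico_add_one_right_eq_Icc,
    Finset.sum_Ico_sub (fun m => z (J m)) (by omega), hJL, hJ1, h0]
  simp [z, Nat.lt_succ_iff.1 hk]

/-- Let `h` be a non-crossing height function, `T` a `U`-tree and
`k ∈ {1,…,b}`.  There are `L ≥ 1`, columns `i_1 ≥ ⋯ ≥ i_L` and rows
`k = j_1 > ⋯ > j_L > j_{L+1} = 0` with `(i_m, j_m) ∈ T` and `(i_m, j_{m+1}) ∈ T` for all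
`m`, such that the unique point `y` of `g(T)` satisfies
`y_k = Σ_{m=1}^{L} (h(i_m, j_m) − h(i_m, j_{m+1}))`. -/
theorem gset_vertex_coordinate (a b : ℕ) (u : ℕ → ℕ) (hu : IsUnimodular a u)
    (hub : ∀ i, i ≤ a → u i ≤ b + 1) (hmax : ∃ i, i ≤ a ∧ u i = b + 1)
    (h : ℕ × ℕ → ℝ) (hnc : NonCrossing (stackSet a u) h)
    (T : Set (ℕ × ℕ)) (hT : IsUTree (stackSet a u) T)
    (y : Fin (b + 1) → ℝ) (hy : y ∈ gSet b (stackSet a u) T h)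
    (k : ℕ) (hk1 : 1 ≤ k) (hk2 : k ≤ b) :
    ∃ (L : ℕ) (I J : ℕ → ℕ), ChainIn T k L I J ∧
      y ⟨k, by omega⟩ =
        ∑ m ∈ Finset.Icc 1 L, (h (I m, J m) - h (I m, J (m + 1))) := by
  obtain ⟨i₀, hi₀, hui₀⟩ := hmax
  obtain ⟨i, hi⟩ := hT.exists_mem_row (k := k) ⟨i₀, hi₀, by omega⟩
  obtain ⟨L, I, J, hC, -⟩ := hT.exists_chainIn k hk1 i hi
  have hb : ∀ p ∈ T, p.2 < b + 1 := fun p hp =>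
    (hT.1 hp).2.trans_le (hub _ (hT.1 hp).1)
  exact ⟨L, I, J, hC, (hC.sum_eq hT.1 hb hy (by omega)).symm⟩
end

section
/- Let δ be an increment vector with respect to ν, let U = U_{δ,ν}, and let U^{max} = U_{δ^{max},ν} where δ^{max} = (ν_1,…,ν_b) (so U^{max} is the set of lattice points weakly above ν in its bounding rectangle). Then the Minkowski sums Σ_{i=0}^{a} conv{e_j ∈ ℝ^{b+1} : (i,j) ∈ U} and Σ_{i=0}^{a} conv{e_j ∈ ℝ^{b+1} : (i,j) ∈ U^{max}} are equal as subsets of ℝ^{b+1}; that is, the generalized permutahedron 𝒫_{U_{δ,ν}} does not depend on the increment vector δ. -/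
open Pointwise

/-- `μ` is a `ν`-path: a monotone lattice path from `(0,0)` to `(a,b)` weakly above `ν`,
where `μ i` (resp. `ν i`) is the number of east steps at height `i`. -/
def IsNuPath (b : ℕ) (ν μ : ℕ → ℕ) : Prop :=
  (∀ j, j ≤ b → ∑ i ∈ Finset.range (j + 1), μ i ≤ ∑ i ∈ Finset.range (j + 1), ν i) ∧
  ∑ i ∈ Finset.range (b + 1), μ i = ∑ i ∈ Finset.range (b + 1), ν i

/-- The stack set `U_{δ,ν}`: the set of lattice points weakly above the path
`(E^{ν_b−δ_b} S ⋯ E^{ν_1−δ_1} S) E^{ν_0} (N E^{δ_1} ⋯ N E^{δ_b})` inside its bounding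
rectangle, in (column `i`, row `j`) coordinates with rows increasing downward
(row `j` has height `b − j`).  The point `(i, j)` belongs to it iff `j ≤ b` and `i` lies
between the column where the descending branch reaches row `j` and the column where the
ascending branch leaves row `j`. -/
def stackSetDN (b : ℕ) (ν δ : ℕ → ℕ) : Set (ℕ × ℕ) :=
  {p | p.2 ≤ b ∧
    (∑ m ∈ Finset.Icc (b - p.2 + 1) b, (ν m - δ m)) ≤ p.1 ∧
    p.1 ≤ (∑ m ∈ Finset.Icc 1 b, (ν m - δ m)) + ν 0 + ∑ m ∈ Finset.Icc 1 (b - p.2), δ m}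

/-- Two families of natural numbers whose strict superlevel sets have the same sizes agree up to
reordering. -/
theorem map_val_eq_of_card_filter_lt_eq {α : Type*} (s : Finset α) (f g : α → ℕ)
    (h : ∀ c, (s.filter fun i => c < f i).card = (s.filter fun i => c < g i).card) :
    s.val.map f = s.val.map g := by
  classical
  have card_fiber (u : α → ℕ) (c : ℕ) : (s.filter fun i => c ≤ u i).card =
      (s.filter fun i => c = u i).card + (s.filter fun i => c < u i).card := by
    rw [← Finset.card_union_of_disjoint
      (Finset.disjoint_filter.2 fun i _ h₁ h₂ => h₂.ne h₁), ← Finset.filter_or]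
    simp only [le_iff_eq_or_lt]
  have card_ge (c : ℕ) :
      (s.filter fun i => c ≤ f i).card = (s.filter fun i => c ≤ g i).card := by
    cases c with
    | zero => simp
    | succ c => simpa only [Nat.succ_le_iff] using h c
  ext c
  rw [Multiset.count_map, Multiset.count_map]
  change (s.filter fun i => c = f i).card = (s.filter fun i => c = g i).card
  have := card_fiber f c
  have := card_fiber g c
  have := h c
  have := card_ge c
  omega

/-- Splitting a sum over `1, …, b` at `h ≤ b`. -/
theorem sum_Icc_one_add_sum_Icc (f : ℕ → ℕ) {h b : ℕ} (hh : h ≤ b) :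
    ∑ m ∈ Finset.Icc 1 h, f m + ∑ m ∈ Finset.Icc (h + 1) b, f m = ∑ m ∈ Finset.Icc 1 b, f m := by
  have e (n : ℕ) : Finset.Icc (n + 1) b = Finset.Ioc n b := Finset.Icc_add_one_left_eq_Ioc n b
  rw [e, e 0, ← zero_add 1, Finset.Icc_add_one_left_eq_Ioc]
  exact Finset.sum_Ioc_consecutive f h.zero_le hh

theorem sum_range_succ_eq_add_sum_Icc (f : ℕ → ℕ) (h : ℕ) :
    ∑ i ∈ Finset.range (h + 1), f i = f 0 + ∑ m ∈ Finset.Icc 1 h, f m := by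
  rw [Finset.range_eq_Ico, Finset.sum_eq_sum_Ico_succ_bot h.succ_pos]
  rfl

theorem sum_tsub_add_sum_eq {b h : ℕ} {ν δ : ℕ → ℕ} (hδ : ∀ m, 1 ≤ m → m ≤ b → δ m ≤ ν m)
    (hh : h ≤ b) :
    ∑ m ∈ Finset.Icc 1 h, (ν m - δ m) + ∑ m ∈ Finset.Icc 1 h, δ m =
      ∑ m ∈ Finset.Icc 1 h, ν m := by
  rw [← Finset.sum_add_distrib]
  refine Finset.sum_congr rfl fun m hm => ?_
  rw [Finset.mem_Icc] at hm
  exact Nat.sub_add_cancel (hδ m hm.1 (hm.2.trans hh))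

/-- The rows of a stack set are nested: each column is an initial segment of the rows. -/
theorem mem_stackSetDN_of_le {b : ℕ} {ν δ : ℕ → ℕ} {i j k : ℕ} (hjk : j ≤ k)
    (h : (i, k) ∈ stackSetDN b ν δ) : (i, j) ∈ stackSetDN b ν δ := by
  obtain ⟨hk, hl, hr⟩ := h
  refine ⟨hjk.trans hk, le_trans ?_ hl, hr.trans ?_⟩
  · exact Finset.sum_le_sum_of_subset (Finset.Icc_subset_Icc (by dsimp only; omega) le_rfl)
  · gcongr

theorem exists_mem_stackSetDN_iff_lt (b : ℕ) (ν δ : ℕ → ℕ) (i : ℕ) :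
    ∃ K, ∀ j, (i, j) ∈ stackSetDN b ν δ ↔ j < K := by
  classical
  have hex : ∃ j, (i, j) ∉ stackSetDN b ν δ := ⟨b + 1, fun h => by simpa using h.1⟩
  refine ⟨Nat.find hex, fun j => ⟨fun hj => ?_, fun hj => not_not.1 (Nat.find_min hex hj)⟩⟩
  by_contra! hle
  exact Nat.find_spec hex (mem_stackSetDN_of_le hle hj)

open Classical in
/-- The size of row `j` of a stack set does not depend on the increment vector. -/
theorem card_row_stackSetDN {b : ℕ} {ν δ : ℕ → ℕ} (hδ : ∀ m, 1 ≤ m → m ≤ b → δ m ≤ ν m)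
    (j : ℕ) :
    ((Finset.range (∑ i ∈ Finset.range (b + 1), ν i + 1)).filter
        fun i => (i, j) ∈ stackSetDN b ν δ).card =
      if j ≤ b then ∑ i ∈ Finset.range (b - j + 1), ν i + 1 else 0 := by
  split_ifs with hj
  · have hh : b - j ≤ b := Nat.sub_le b j
    have h₁ := sum_Icc_one_add_sum_Icc (fun m => ν m - δ m) hh
    have h₂ := sum_Icc_one_add_sum_Icc δ hh
    have h₃ := sum_tsub_add_sum_eq hδ hh
    have h₄ := sum_tsub_add_sum_eq hδ le_rfl
    have h₅ := sum_range_succ_eq_add_sum_Icc ν (b - j)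
    have h₆ := sum_range_succ_eq_add_sum_Icc ν b
    have hrow : (Finset.range (∑ i ∈ Finset.range (b + 1), ν i + 1)).filter
        (fun i => (i, j) ∈ stackSetDN b ν δ) =
        Finset.Icc (∑ m ∈ Finset.Icc (b - j + 1) b, (ν m - δ m))
          (∑ m ∈ Finset.Icc 1 b, (ν m - δ m) + ν 0 + ∑ m ∈ Finset.Icc 1 (b - j), δ m) := by
      ext i
      rw [Finset.mem_filter, Finset.mem_range, Finset.mem_Icc]
      simp only [stackSetDN, Set.mem_ofPred_eq]
      omega
    rw [hrow, Nat.card_Icc]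
    omega
  · rw [Finset.card_eq_zero, Finset.filter_eq_empty_iff]
    exact fun i _ h => hj h.1

/-- The generalized permutahedron `𝒫_{U_{δ,ν}}` — the Minkowski sum over
the columns `i ∈ {0,…,a}` of the simplices `conv {e_j : (i,j) ∈ U_{δ,ν}} ⊆ ℝ^{b+1}` —
does not depend on the increment vector `δ`: it coincides with the one obtained from
`δ^{max} = (ν_1,…,ν_b)`, whose stack set is the set of lattice points weakly above `ν`. -/
theorem gen_permutahedron_independent_of_delta (b : ℕ) (hb : 1 ≤ b) (ν δ : ℕ → ℕ)
    (hδ : ∀ m, 1 ≤ m → m ≤ b → δ m ≤ ν m)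
    (a : ℕ) (ha : a = ∑ i ∈ Finset.range (b + 1), ν i) :
    (∑ i ∈ Finset.range (a + 1),
        convexHull ℝ {y : Fin (b + 1) → ℝ | ∃ j : Fin (b + 1),
          (i, (j : ℕ)) ∈ stackSetDN b ν δ ∧ y = Pi.single j 1}) =
      ∑ i ∈ Finset.range (a + 1),
        convexHull ℝ {y : Fin (b + 1) → ℝ | ∃ j : Fin (b + 1),
          (i, (j : ℕ)) ∈ stackSetDN b ν (fun m => ν m) ∧ y = Pi.single j 1} := by
  choose K hK using exists_mem_stackSetDN_iff_lt b ν δ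
  choose K' hK' using exists_mem_stackSetDN_iff_lt b ν (fun m => ν m)
  have hmap : (Finset.range (a + 1)).val.map K = (Finset.range (a + 1)).val.map K' := by
    classical
    refine map_val_eq_of_card_filter_lt_eq _ K K' fun c => ?_
    simp only [← hK, ← hK']
    rw [ha, card_row_stackSetDN hδ, card_row_stackSetDN fun m _ _ => le_rfl]
  let simplex (k : ℕ) : Set (Fin (b + 1) → ℝ) :=
    convexHull ℝ {y | ∃ j : Fin (b + 1), (j : ℕ) < k ∧ y = Pi.single j 1}
  simp only [hK, hK']
  change ((Finset.range (a + 1)).val.map fun i => simplex (K i)).sum =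
    ((Finset.range (a + 1)).val.map fun i => simplex (K' i)).sum
  simpa only [Multiset.map_map, Function.comp_def] using congrArg (fun m => (m.map simplex).sum) hmap
end

section
/- Let T be a plane binary tree with n + 1 internal nodes, with Loday coordinate L(T) = (ℓ_1,…,ℓ_{n+1}) and canonical coordinate C(T) = (c_n,…,c_1). Then for every 1 ≤ i ≤ n, c_i = (ℓ_1 + ℓ_2 + ⋯ + ℓ_i) − (1 + 2 + ⋯ + i) = Σ_{k=1}^{i} ℓ_k − i(i+1)/2; that is, the canonical realization of the associahedron is the image of Loday's realization under this affine map. -/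
/-- Plane binary trees. -/
inductive PBT : Type
  | leaf : PBT
  | node : PBT → PBT → PBT

/-- The number of leaves of a plane binary tree. -/
def PBT.leaves : PBT → ℕ
  | .leaf => 1
  | .node l r => l.leaves + r.leaves

/-- The number of internal nodes of a plane binary tree. -/
def PBT.internals : PBT → ℕ
  | .leaf => 0
  | .node l r => l.internals + r.internals + 1

/-- Loday's coordinates `(ℓ_1, …, ℓ_{n+1})` of a plane binary tree: the list, in in-order,
of the products (number of leaves of the left subtree) × (number of leaves of the right
subtree) over the internal nodes. -/
def PBT.loday : PBT → List ℕ
  | .leaf => []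
  | .node l r => l.loday ++ (l.leaves * r.leaves) :: r.loday

/-- The staircase drawing of a plane binary tree, as a set of lattice points in
(column `i`, row `j`) coordinates with rows increasing downward: the root is drawn at the
top-left corner `(0,0)`, the left subtree is drawn below it (shifted down by the number of
leaves of the right subtree), the right subtree to its right (shifted right by the number
of leaves of the left subtree), and the leaves end up on the diagonal.  A tree with
`n + 1` internal nodes is drawn on the staircase `{(i,j) : i + j ≤ n + 1}`, and its drawing
is the corresponding maximal compatible set (`U`-tree): the left child of an element is the
next element of the drawing below it in its column, and its right child is the next element
of the drawing to its right in its row. -/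
def PBT.draw : PBT → Set (ℕ × ℕ)
  | .leaf => {(0, 0)}
  | .node l r =>
      {(0, 0)} ∪ (fun p => (p.1, p.2 + r.leaves)) '' l.draw ∪
        (fun p => (p.1 + l.leaves, p.2)) '' r.draw

theorem PBT.leaves_eq_internals_add_one (T : PBT) : T.leaves = T.internals + 1 := by
  induction T with
  | leaf => rfl
  | node l r ihl ihr => simp only [leaves, internals, ihl, ihr]; omega

theorem PBT.length_loday (T : PBT) : T.loday.length = T.internals := by
  induction T with
  | leaf => rfl
  | node l r ihl ihr =>
    simp only [loday, internals, List.length_append, List.length_cons, ihl, ihr]; omega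

theorem PBT.zero_mem_draw (T : PBT) : (0, 0) ∈ T.draw := by
  cases T <;> simp [draw]

theorem PBT.add_le_internals_of_mem_draw {T : PBT} {x j : ℕ} (h : (x, j) ∈ T.draw) :
    x + j ≤ T.internals := by
  induction T generalizing x j with
  | leaf => simp_all [draw, internals]
  | node l r ihl ihr =>
    have hl := l.leaves_eq_internals_add_one
    have hr := r.leaves_eq_internals_add_one
    simp only [draw, Set.mem_union, Set.mem_singleton_iff, Set.mem_image, Prod.exists,
      Prod.mk.injEq] at h
    simp only [internals]
    rcases h with (⟨rfl, rfl⟩ | ⟨p, q, h, rfl, rfl⟩) | ⟨p, q, h, rfl, rfl⟩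
    · omega
    · have := ihl h; omega
    · have := ihr h; omega

theorem sum_range_getD_append_of_le (s t : List ℕ) {m : ℕ} (hm : m ≤ s.length) :
    ∑ k ∈ Finset.range m, ((s ++ t).getD k 0 : ℤ) = ∑ k ∈ Finset.range m, (s.getD k 0 : ℤ) :=
  Finset.sum_congr rfl fun k hk => by
    rw [List.getD_append _ _ _ _ ((Finset.mem_range.1 hk).trans_le hm)]

theorem sum_range_getD_append_cons (s t : List ℕ) (a m : ℕ) :
    ∑ k ∈ Finset.range (s.length + (m + 1)), ((s ++ a :: t).getD k 0 : ℤ) =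
      ∑ k ∈ Finset.range s.length, (s.getD k 0 : ℤ) + a +
        ∑ k ∈ Finset.range m, (t.getD k 0 : ℤ) := by
  rw [Finset.sum_range_add, sum_range_getD_append_of_le s _ le_rfl, Finset.sum_range_succ']
  simp only [List.getD_append_right _ _ _ _ (Nat.le_add_right _ _), Nat.add_sub_cancel_left,
    List.getD_cons_zero, List.getD_cons_succ]
  ring

theorem two_mul_sum_Icc_one_cast (m : ℕ) :
    2 * ∑ k ∈ Finset.Icc 1 m, (k : ℤ) = m * (m + 1) := by
  induction m with
  | zero => simp
  | succ m ih =>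
    rw [Finset.sum_Icc_succ_top (by omega), mul_add, ih]
    push_cast
    ring

/-- The affine function of Loday's coordinates attached to row `j` of the drawing. -/
def PBT.rowValue (T : PBT) (j : ℕ) : ℤ :=
  ∑ k ∈ Finset.range (T.internals - j), (T.loday.getD k 0 : ℤ) -
    ∑ k ∈ Finset.Icc 1 (T.internals - j), (k : ℤ)

theorem PBT.rowValue_node_add (l r : PBT) (q : ℕ) :
    (node l r).rowValue (q + r.leaves) = l.rowValue q := by
  have h : (node l r).internals - (q + r.leaves) = l.internals - q := by
    have := r.leaves_eq_internals_add_one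
    simp only [internals]; omega
  rw [rowValue, rowValue, h, loday,
    sum_range_getD_append_of_le _ _ (by rw [length_loday]; omega)]

theorem PBT.rowValue_node_of_le (l r : PBT) {q : ℕ} (hq : q ≤ r.internals) :
    (node l r).rowValue q = l.rowValue 0 + r.rowValue q + l.leaves * q := by
  obtain ⟨m, hm⟩ := Nat.exists_eq_add_of_le hq
  have h : (node l r).internals - q = l.loday.length + (m + 1) := by
    simp only [internals, length_loday]; omega
  have h' : r.internals - q = m := by omega
  rw [rowValue, rowValue, rowValue, h, h', loday, sum_range_getD_append_cons, length_loday,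
    Nat.sub_zero]
  have e₁ := two_mul_sum_Icc_one_cast (l.internals + (m + 1))
  have e₂ := two_mul_sum_Icc_one_cast l.internals
  have e₃ := two_mul_sum_Icc_one_cast m
  rw [leaves_eq_internals_add_one l, leaves_eq_internals_add_one r, hm]
  push_cast at e₁ ⊢
  linarith

theorem PBT.rowValue_zero (T : PBT) : T.rowValue 0 = 0 := by
  induction T with
  | leaf => simp [rowValue, internals]
  | node l r ihl ihr => simp [rowValue_node_of_le, ihl, ihr]

theorem PBT.rowValue_sub_rowValue {T : PBT} {x j j' : ℕ} (h : (x, j) ∈ T.draw)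
    (h' : (x, j') ∈ T.draw) : T.rowValue j - T.rowValue j' = x * ((j : ℤ) - j') := by
  induction T generalizing x j j' with
  | leaf => simp_all [draw]
  | node l r ihl ihr =>
    have hl := l.leaves_eq_internals_add_one
    simp only [draw, Set.mem_union, Set.mem_singleton_iff, Set.mem_image, Prod.exists,
      Prod.mk.injEq] at h h'
    rcases h with (⟨rfl, rfl⟩ | ⟨p, q, h, rfl, rfl⟩) | ⟨p, q, h, rfl, rfl⟩ <;>
    rcases h' with (⟨hx, rfl⟩ | ⟨p', q', h', hx, rfl⟩) | ⟨p', q', h', hx, rfl⟩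
    · simp
    · subst hx
      have := ihl l.zero_mem_draw h'
      simp_all [rowValue_node_add, rowValue_zero]
    · omega
    · subst hx
      have := ihl l.zero_mem_draw h
      simp_all [rowValue_node_add, rowValue_zero]
    · subst hx
      rw [rowValue_node_add, rowValue_node_add, ihl h h']
      push_cast
      ring
    · have := add_le_internals_of_mem_draw h
      omega
    · omega
    · have := add_le_internals_of_mem_draw h'
      omega
    · obtain rfl : p' = p := by omega
      have := add_le_internals_of_mem_draw h
      have := add_le_internals_of_mem_draw h'
      rw [rowValue_node_of_le l r (by omega), rowValue_node_of_le l r (by omega)]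
      have := ihr h h'
      push_cast
      linarith

theorem PBT.exists_chainIn_draw (T : PBT) {k : ℕ} (hk : 1 ≤ k) (hkT : k ≤ T.internals) :
    ∃ (L : ℕ) (I J : ℕ → ℕ), ChainIn T.draw k L I J := by
  induction T generalizing k with
  | leaf => simp only [internals] at hkT; omega
  | node l r ihl ihr =>
    have hr := r.leaves_eq_internals_add_one
    simp only [internals] at hkT
    have memL {p q : ℕ} (h : (p, q) ∈ l.draw) : (p, q + r.leaves) ∈ (node l r).draw :=
      .inl (.inr ⟨(p, q), h, rfl⟩)
    have memR {p q : ℕ} (h : (p, q) ∈ r.draw) : (p + l.leaves, q) ∈ (node l r).draw :=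
      .inr ⟨(p, q), h, rfl⟩
    have root_mem : (0, r.leaves) ∈ (node l r).draw := by
      simpa using memL l.zero_mem_draw
    rcases lt_trichotomy k r.leaves with h | rfl | h
    · obtain ⟨L, I, J, hL, hJ1, hJL, hI, hJ, hT⟩ := ihr hk (by omega)
      exact ⟨L, fun m => I m + l.leaves, J, hL, hJ1, hJL,
        fun m h₁ h₂ => Nat.add_le_add_right (hI m h₁ h₂) _, hJ,
        fun m h₁ h₂ => ⟨memR (hT m h₁ h₂).1, memR (hT m h₁ h₂).2⟩⟩
    · refine ⟨1, fun _ => 0, fun m => if m = 1 then r.leaves else 0, le_rfl, by simp, by simp,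
        by simp, fun m h₁ h₂ => ?_, fun m h₁ h₂ => ?_⟩ <;> obtain rfl : m = 1 := by omega
      · simpa using Nat.pos_of_ne_zero (by omega)
      · simpa using ⟨root_mem, zero_mem_draw _⟩
    · obtain ⟨L, I, J, hL, hJ1, hJL, hI, hJ, hT⟩ :=
        ihl (k := k - r.leaves) (by omega) (by omega)
      refine ⟨L + 1, fun m => if m ≤ L then I m else 0,
        fun m => if m ≤ L + 1 then J m + r.leaves else 0, by omega, ?_, by simp,
        fun m h₁ h₂ => ?_, fun m h₁ h₂ => ?_, fun m h₁ h₂ => ?_⟩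
      · simp only [Nat.le_add_left, if_true, hJ1]; omega
      · rcases Nat.lt_or_ge m L with h | h
        · simpa [h, h.le] using hI m h₁ h
        · simp [show ¬ m + 1 ≤ L by omega]
      · rcases Nat.lt_or_ge L m with h | h
        · obtain rfl : m = L + 1 := by omega
          simp; omega
        · simpa [h, h₂] using hJ m h₁ h
      · rcases Nat.lt_or_ge L m with h | h
        · obtain rfl : m = L + 1 := by omega
          simpa [hJL] using ⟨root_mem, zero_mem_draw _⟩
        · simpa [h, h₂] using ⟨memL (hT m h₁ h).1, memL (hT m h₁ h).2⟩

theorem ChainIn.sum_eq_rowValue {T : PBT} {k L : ℕ} {I J : ℕ → ℕ}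
    (h : ChainIn T.draw k L I J) :
    ∑ m ∈ Finset.Icc 1 L, (I m : ℤ) * ((J m : ℤ) - (J (m + 1) : ℤ)) = T.rowValue k := by
  obtain ⟨-, hJ1, hJL, -, -, hT⟩ := h
  have partial_sum (M : ℕ) (hM : M ≤ L) :
      ∑ m ∈ Finset.Icc 1 M, (I m : ℤ) * ((J m : ℤ) - (J (m + 1) : ℤ)) =
        T.rowValue (J 1) - T.rowValue (J (M + 1)) := by
    induction M with
    | zero => simp
    | succ M ih =>
      have hmem := hT (M + 1) (by omega) hM
      rw [Finset.sum_Icc_succ_top (by omega), ih (by omega),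
        ← PBT.rowValue_sub_rowValue hmem.1 hmem.2]
      ring
  rw [partial_sum L le_rfl, hJL, hJ1, PBT.rowValue_zero, sub_zero]

/-- Let `T` be a plane binary tree with `n + 1` internal nodes, with
Loday coordinate `L(T) = (ℓ_1, …, ℓ_{n+1})` and canonical coordinate `C(T) = (c_n, …, c_1)`,
where `c_i` is the area below the path in the staircase drawing of `T` joining the leftmost
element in the row of height `i` (that is, row `n + 1 − i`) to the root — computed as
`Σ_m i_m (j_m − j_{m+1})` over any corner chain of such a path, all of which give the same
value.  Then `c_i = (ℓ_1 + ⋯ + ℓ_i) − (1 + 2 + ⋯ + i)` for every `1 ≤ i ≤ n`: the canonical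
realization of the associahedron is the image of Loday's realization under this affine
map. -/
theorem canonical_eq_affine_image_of_loday (n : ℕ) (T : PBT) (hT : T.internals = n + 1)
    (i : ℕ) (hi1 : 1 ≤ i) (hi2 : i ≤ n) :
    (∃ (L : ℕ) (I J : ℕ → ℕ), ChainIn T.draw (n + 1 - i) L I J) ∧
    ∀ (L : ℕ) (I J : ℕ → ℕ), ChainIn T.draw (n + 1 - i) L I J →
      (∑ m ∈ Finset.Icc 1 L, (I m : ℤ) * ((J m : ℤ) - (J (m + 1) : ℤ))) =
        (∑ k ∈ Finset.range i, (T.loday.getD k 0 : ℤ)) - ∑ k ∈ Finset.Icc 1 i, (k : ℤ) := by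
  refine ⟨T.exists_chainIn_draw (by omega) (by omega), fun L I J h => ?_⟩
  rw [h.sum_eq_rowValue, PBT.rowValue, hT, Nat.sub_sub_self (by omega)]
end
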